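/- If S and S′ are subsets of {1,…,n} with 0 < Γ_{S′} < Γ_S, then JSD(p‖q_S) < JSD(p‖q_{S′}); consequently, minimizing the Jensen–Shannon divergence JSD(p‖q_S) over subsets S is achieved exactly by maximizing the selected probability mass Γ_S. -/

import Mathlib

/-- Kullback–Leibler divergence `KL(a‖b) = Σ_i a_i ln(a_i/b_i)`
(with the convention `0 · ln 0 = 0`). -/
noncomputable def KL {n : ℕ} (a b : Fin n → ℝ) : ℝ :=
  ∑ i, a i * Real.log (a i / b i)

/-- Jensen–Shannon divergence `JSD(a‖b) = ½ KL(a‖M) + ½ KL(b‖M)` with `M = (a+b)/2`. -/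
noncomputable def JSD {n : ℕ} (a b : Fin n → ℝ) : ℝ :=
  (1 / 2) * KL a (fun i => (a i + b i) / 2) + (1 / 2) * KL b (fun i => (a i + b i) / 2)

/-- The truncation of `p` to a subset `S`: `q_S(i) = p_i / Γ_S` for `i ∈ S`, else `0`. -/
noncomputable def qtrunc {n : ℕ} (p : Fin n → ℝ) (S : Finset (Fin n)) : Fin n → ℝ :=
  fun i => if i ∈ S then p i / ∑ j ∈ S, p j else 0

/-- The closed form of the divergence from `p` to its truncation to a set of mass `g`. -/
noncomputable def truncJSD (g : ℝ) : ℝ :=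
  Real.log 2 + (1 / 2) * (g * Real.log g - (g + 1) * Real.log (g + 1))

theorem truncJSD_strictAntiOn : StrictAntiOn truncJSD (Set.Ioi 0) := by
  have hderiv : ∀ x : ℝ, 0 < x →
      HasDerivAt truncJSD ((1 / 2) * (Real.log x - Real.log (x + 1))) x := by
    intro x hx
    have h1 := Real.hasDerivAt_mul_log hx.ne'
    have h2 := (Real.hasDerivAt_mul_log (by positivity : x + 1 ≠ 0)).comp_add_const x 1
    have h3 := ((h1.sub h2).const_mul (1 / 2)).const_add (Real.log 2)
    exact h3.congr_deriv (by ring)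
  refine strictAntiOn_of_deriv_neg (convex_Ioi 0)
    (fun x hx => (hderiv x hx).continuousAt.continuousWithinAt) ?_
  intro x hx
  rw [interior_Ioi] at hx
  rw [(hderiv x hx).deriv]
  have := Real.log_lt_log hx (lt_add_one x)
  linarith

theorem JSD_qtrunc {n : ℕ} (p : Fin n → ℝ) (hp : ∀ i, 0 < p i) (hsum : ∑ i, p i = 1)
    (S : Finset (Fin n)) (hS : 0 < ∑ i ∈ S, p i) :
    JSD p (qtrunc p S) = truncJSD (∑ i ∈ S, p i) := by
  unfold JSD KL qtrunc truncJSD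
  set g := ∑ i ∈ S, p i with hg
  have hg1 : 0 < g + 1 := by linarith
  have h1 : ∀ i, p i * Real.log (p i / ((p i + if i ∈ S then p i / g else 0) / 2)) =
      p i * Real.log 2 + if i ∈ S then p i * (Real.log g - Real.log (g + 1)) else 0 := by
    intro i
    have hi := hp i
    split_ifs
    · have : p i / ((p i + p i / g) / 2) = 2 * (g / (g + 1)) := by field_simp
      rw [this, Real.log_mul two_ne_zero (by positivity), Real.log_div hS.ne' hg1.ne']
      ring
    · have : p i / ((p i + 0) / 2) = 2 := by rw [add_zero]; field_simp
      rw [this, add_zero]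
  have h2 : ∀ i, (if i ∈ S then p i / g else 0) *
      Real.log ((if i ∈ S then p i / g else 0) / ((p i + if i ∈ S then p i / g else 0) / 2)) =
      if i ∈ S then p i * ((Real.log 2 - Real.log (g + 1)) / g) else 0 := by
    intro i
    have hi := hp i
    split_ifs
    · have : p i / g / ((p i + p i / g) / 2) = 2 / (g + 1) := by field_simp
      rw [this, Real.log_div two_ne_zero hg1.ne']
      ring
    · rw [zero_mul]
  simp only [h1, h2, Finset.sum_add_distrib, Finset.sum_ite_mem, Finset.univ_inter,
    ← Finset.sum_mul, hsum, ← hg]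
  field_simp
  ring

/-- If `0 < Γ_{S'} < Γ_S` then `JSD(p‖q_S) < JSD(p‖q_{S'})`; consequently,
minimizing `JSD(p‖q_S)` over subsets is achieved exactly by maximizing `Γ_S`. -/
theorem jsd_lt_of_mass_gt {n : ℕ} (p : Fin n → ℝ) (hp : ∀ i, 0 < p i)
    (hsum : ∑ i, p i = 1) :
    (∀ S S' : Finset (Fin n), 0 < ∑ i ∈ S', p i → (∑ i ∈ S', p i) < (∑ i ∈ S, p i) →
      JSD p (qtrunc p S) < JSD p (qtrunc p S')) ∧
    (∀ S : Finset (Fin n), 0 < ∑ i ∈ S, p i →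
      ((∀ S' : Finset (Fin n), 0 < ∑ i ∈ S', p i → (∑ i ∈ S', p i) ≤ (∑ i ∈ S, p i)) ↔
       (∀ S' : Finset (Fin n), 0 < ∑ i ∈ S', p i →
          JSD p (qtrunc p S) ≤ JSD p (qtrunc p S')))) := by
  have hlt : ∀ S S' : Finset (Fin n), 0 < ∑ i ∈ S', p i →
      (∑ i ∈ S', p i) < (∑ i ∈ S, p i) → JSD p (qtrunc p S) < JSD p (qtrunc p S') := by
    intro S S' hS' h
    rw [JSD_qtrunc p hp hsum S (hS'.trans h), JSD_qtrunc p hp hsum S' hS']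
    exact truncJSD_strictAntiOn hS' (hS'.trans h) h
  refine ⟨hlt, fun S hS => ⟨fun h S' hS' => ?_, fun h S' hS' => ?_⟩⟩
  · rw [JSD_qtrunc p hp hsum S hS, JSD_qtrunc p hp hsum S' hS']
    exact truncJSD_strictAntiOn.antitoneOn hS' hS (h S' hS')
  · by_contra! hcon
    exact absurd (h S' hS') (not_le.mpr (hlt S' S hS hcon))
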